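/- The image of F on L_n is equal to {0}, to (L_n)^m, or to (L_n)^{m+1}. In particular, the image of every multilinear polynomial on the n-dimensional null-filiform Leibniz algebra L_n is a K-vector subspace of L_n (the analogue of the L'vov–Kaplansky conjecture holds for L_n). -/

import Mathlib

/-- The multiplication of the `n`-dimensional null-filiform Leibniz algebra `L_n`,
realized on coordinate vectors `Fin n → K`: the bilinear map determined by
`e_i · e_1 = e_{i+1}` for `1 ≤ i ≤ n-1` and all other products of basis vectors zero. -/
def nfMul (K : Type*) [Field K] (n : ℕ) (x y : Fin n → K) : Fin n → K :=
  fun k => if (k : ℕ) = 0 then 0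
    else y ⟨0, Nat.lt_of_le_of_lt (Nat.zero_le _) k.isLt⟩ *
         x ⟨(k : ℕ) - 1, Nat.lt_of_le_of_lt (Nat.sub_le _ _) k.isLt⟩

/-- The left-normed product `a₁a₂⋯a_k = (⋯((a₁a₂)a₃)⋯)a_k` of a list of elements
of `L_n` (junk value `0` for the empty list). -/
def lnProd (K : Type*) [Field K] (n : ℕ) : List (Fin n → K) → (Fin n → K)
  | [] => 0
  | a :: t => t.foldl (nfMul K n) a

/-- The span of the basis vectors `e_k, …, e_n` of `L_n`; this is `{0}` when `k > n`. -/
def nfPow (K : Type*) [Field K] (n k : ℕ) : Submodule K (Fin n → K) :=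
  Submodule.span K {x | ∃ i : Fin n, k ≤ (i : ℕ) + 1 ∧ x = Pi.single i (1 : K)}

/-- The multilinear map `F(v₁, …, v_m) = Σ_{σ ∈ S_m} α_σ · v_{σ(1)}v_{σ(2)}⋯v_{σ(m)}`
(left-normed products) on `L_n`, attached to a family of scalars `α_σ` indexed by
permutations of `{1, …, m}`. -/
noncomputable def multF (K : Type*) [Field K] (n m : ℕ)
    (α : Equiv.Perm (Fin m) → K) (v : Fin m → (Fin n → K)) : Fin n → K :=
  ∑ σ : Equiv.Perm (Fin m), α σ • lnProd K n (List.ofFn fun i => v (σ i))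

theorem mem_nfPow_iff (K : Type*) [Field K] (n k : ℕ) (x : Fin n → K) :
    x ∈ nfPow K n k ↔ ∀ i : Fin n, (i : ℕ) + 1 < k → x i = 0 := by
  constructor
  · intro hx
    unfold nfPow at hx
    induction hx using Submodule.span_induction with
    | mem y hy =>
      obtain ⟨j, hj, rfl⟩ := hy
      intro i hi
      rw [Pi.single_apply, if_neg]
      rintro rfl
      omega
    | zero => intro i _; rfl
    | add y z _ _ h1 h2 => intro i hi; simp [h1 i hi, h2 i hi]
    | smul a y _ h => intro i hi; simp [h i hi]
  · intro h
    rw [pi_eq_sum_univ' x]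
    refine Submodule.sum_mem _ fun i _ => ?_
    by_cases hi : (i : ℕ) + 1 < k
    · rw [h i hi, zero_smul]; exact Submodule.zero_mem _
    · refine Submodule.smul_mem _ _ (Submodule.subset_span ⟨i, by omega, ?_⟩)
      ext j
      simp [Pi.single_apply, eq_comm]

theorem foldl_nfMul (K : Type*) [Field K] (n : ℕ) (hn : 0 < n) (t : List (Fin n → K))
    (a : Fin n → K) (k : Fin n) :
    t.foldl (nfMul K n) a k = if (k : ℕ) < t.length then 0 else
      (t.map (fun y => y ⟨0, hn⟩)).prod *
        a ⟨(k : ℕ) - t.length, Nat.lt_of_le_of_lt (Nat.sub_le _ _) k.isLt⟩ := by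
  induction t generalizing a with
  | nil => simp
  | cons y t ih =>
    rw [List.foldl_cons, ih]
    simp only [List.length_cons, List.map_cons, List.prod_cons, nfMul]
    by_cases h1 : (k : ℕ) < t.length
    · rw [if_pos h1, if_pos (by omega)]
    · rw [if_neg h1]
      by_cases h2 : (k : ℕ) < t.length + 1
      · rw [if_pos h2, if_pos (by omega), mul_zero]
      · rw [if_neg h2, if_neg (by omega)]
        have : (k : ℕ) - t.length - 1 = k - (t.length + 1) := by omega
        simp only [this]
        ring

theorem lnProd_perm (K : Type*) [Field K] (n p : ℕ) (hn : 0 < n)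
    (v : Fin (p + 1) → Fin n → K) (σ : Equiv.Perm (Fin (p + 1))) (k : Fin n) :
    lnProd K n (List.ofFn fun i => v (σ i)) k = if (k : ℕ) < p then 0 else
      (∏ i ∈ Finset.univ.erase (σ 0), v i ⟨0, hn⟩) *
        v (σ 0) ⟨(k : ℕ) - p, Nat.lt_of_le_of_lt (Nat.sub_le _ _) k.isLt⟩ := by
  rw [List.ofFn_succ, lnProd, foldl_nfMul K n hn]
  simp only [List.length_ofFn, List.map_ofFn, List.prod_ofFn, Function.comp_apply]
  have : ∏ i : Fin p, v (σ i.succ) ⟨0, hn⟩ =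
      ∏ i ∈ Finset.univ.erase (σ 0), v i ⟨0, hn⟩ := by
    refine Finset.prod_bij (fun i _ => σ i.succ) ?_ ?_ ?_ ?_
    · intro i _
      simp [Fin.succ_ne_zero]
    · intro i _ j _ h
      simpa using h
    · intro b hb
      have hb' : σ.symm b ≠ 0 := by
        intro h
        apply (Finset.mem_erase.mp hb).1
        rw [← h]; simp
      obtain ⟨i, hi⟩ := Fin.exists_succ_eq.mpr hb'
      exact ⟨i, Finset.mem_univ _, by rw [hi]; simp⟩
    · intro i _; rfl
  rw [this]

theorem multF_coord (K : Type*) [Field K] (n p : ℕ) (hn : 0 < n)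
    (α : Equiv.Perm (Fin (p + 1)) → K) (v : Fin (p + 1) → Fin n → K) (k : Fin n) :
    multF K n (p + 1) α v k = if (k : ℕ) < p then 0 else
      ∑ j, (∑ σ with σ 0 = j, α σ) * ((∏ i ∈ Finset.univ.erase j, v i ⟨0, hn⟩) *
        v j ⟨(k : ℕ) - p, Nat.lt_of_le_of_lt (Nat.sub_le _ _) k.isLt⟩) := by
  simp only [multF, Finset.sum_apply, Pi.smul_apply, smul_eq_mul, lnProd_perm K n p hn]
  split_ifs with h
  · simp
  · rw [← Finset.sum_fiberwise Finset.univ (fun σ : Equiv.Perm (Fin (p + 1)) => σ 0)]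
    refine Finset.sum_congr rfl fun j _ => ?_
    rw [Finset.sum_mul]
    refine Finset.sum_congr rfl fun σ hσ => ?_
    rw [(Finset.mem_filter.mp hσ).2]

theorem multF_surj (K : Type*) [Field K] (n p : ℕ) (hn : 0 < n)
    (α : Equiv.Perm (Fin (p + 1)) → K) (j : Fin (p + 1))
    (hj : (∑ σ with σ 0 = j, α σ) ≠ 0) (w : Fin n → K)
    (hw : ∀ k : Fin n, (k : ℕ) < p → w k = 0)
    (hw' : (∑ j, ∑ σ with σ 0 = j, α σ) = 0 → ∀ k : Fin n, (k : ℕ) = p → w k = 0) :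
    ∃ v, multF K n (p + 1) α v = w := by
  generalize hβ : (fun j => ∑ σ : Equiv.Perm (Fin (p + 1)) with σ 0 = j, α σ) = β
  have hβ' : ∀ j, (∑ σ : Equiv.Perm (Fin (p + 1)) with σ 0 = j, α σ) = β j :=
    fun j => congrFun hβ j
  simp only [hβ'] at hj hw'
  let u : Fin n → K := fun k => if h : (k : ℕ) + p < n then
    (if (k : ℕ) = 0 then w ⟨k + p, h⟩ / ∑ j, β j else w ⟨k + p, h⟩ / β j) else 0
  let e : Fin n → K := fun k => if (k : ℕ) = 0 then 1 else 0
  refine ⟨fun i => if i = j then u else e, ?_⟩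
  ext k
  rw [multF_coord K n p hn]
  split_ifs with h
  · exact (hw k h).symm
  simp only [hβ']
  by_cases hk : (k : ℕ) = p
  · have hz : ∀ h', (⟨(k : ℕ) - p, h'⟩ : Fin n) = ⟨0, hn⟩ := by
      intro h'; ext; simp [hk]
    simp only [hz]
    simp only [Finset.prod_erase_mul _ _ (Finset.mem_univ _)]
    rw [← Finset.sum_mul, Finset.prod_eq_single j]
    · have hpn : p < n := hk ▸ k.isLt
      have hkp : k = ⟨p, hpn⟩ := Fin.ext hk
      simp only [if_true, u, zero_add, dif_pos hpn, ← hkp]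
      by_cases hs : ∑ j, β j = 0
      · rw [hw' hs k hk]; simp
      · field_simp
    · intro i _ hi
      simp [hi, e]
    · simp
  · rw [Finset.sum_eq_single j]
    · rw [Finset.prod_eq_one]
      · have h1 : (k : ℕ) - p + p = k := by omega
        have h2 : (k : ℕ) - p ≠ 0 := by omega
        simp only [if_true, u, h1, dif_pos k.isLt, if_neg h2]
        field_simp
      · intro i hi
        simp [(Finset.mem_erase.mp hi).1, e]
    · intro i _ hi
      have h2 : (k : ℕ) - p ≠ 0 := by omega
      simp only [if_neg hi, e, if_neg h2, mul_zero]
    · simp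

/-- The image of the multilinear map `F` on `L_n` equals `{0}`, `(L_n)^m`, or
`(L_n)^{m+1}`.  In particular, the image of every multilinear polynomial on the
`n`-dimensional null-filiform Leibniz algebra is a `K`-vector subspace of `L_n`
(the analogue of the L'vov–Kaplansky conjecture holds for `L_n`). -/
theorem Ln_Lvov_Kaplansky (K : Type*) [Field K] (n m : ℕ)
    (hn : 1 ≤ n) (hm : 1 ≤ m) (α : Equiv.Perm (Fin m) → K) :
    Set.range (multF K n m α) = ({0} : Set (Fin n → K)) ∨
    Set.range (multF K n m α) = (nfPow K n m : Set (Fin n → K)) ∨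
    Set.range (multF K n m α) = (nfPow K n (m + 1) : Set (Fin n → K)) := by
  obtain ⟨p, rfl⟩ : ∃ p, m = p + 1 := ⟨m - 1, by omega⟩
  by_cases hall : ∀ j, (∑ σ : Equiv.Perm (Fin (p + 1)) with σ 0 = j, α σ) = 0
  · left
    have h0 : ∀ v, multF K n (p + 1) α v = 0 := by
      intro v
      ext k
      rw [multF_coord K n p hn]
      simp [hall]
    ext w
    constructor
    · rintro ⟨v, rfl⟩
      exact h0 v
    · intro h
      exact ⟨0, (h0 0).trans h.symm⟩
  · right
    push Not at hall
    obtain ⟨j, hj⟩ := hall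
    by_cases hs : (∑ j, ∑ σ : Equiv.Perm (Fin (p + 1)) with σ 0 = j, α σ) = 0
    · right
      ext w
      rw [SetLike.mem_coe, mem_nfPow_iff]
      constructor
      · rintro ⟨v, rfl⟩ k hk
        rw [multF_coord K n p hn]
        split_ifs with h
        · rfl
        · have hz : ∀ h', (⟨(k : ℕ) - p, h'⟩ : Fin n) = ⟨0, hn⟩ := by
            intro h'
            ext
            simp only
            omega
          simp only [hz]
          simp only [Finset.prod_erase_mul _ _ (Finset.mem_univ _)]
          rw [← Finset.sum_mul, hs, zero_mul]
      · intro h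
        exact multF_surj K n p hn α j hj w (fun k hk => h k (by omega))
          (fun _ k hk => h k (by omega))
    · left
      ext w
      rw [SetLike.mem_coe, mem_nfPow_iff]
      constructor
      · rintro ⟨v, rfl⟩ k hk
        rw [multF_coord K n p hn, if_pos (by omega)]
      · intro h
        exact multF_surj K n p hn α j hj w (fun k hk => h k (by omega))
          (fun h0 => absurd h0 hs)
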